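/- Let E ⊆ ℝ be a nonempty closed set and let u : ℂ → ℝ be continuous on ℂ, equal to 0 on E, positive and harmonic on ℂ∖E, symmetric (u(conj z) = u(z) for all z), and satisfy u(z) ≤ A(1+|z|) for some constant A. Then for every x ∈ ℝ the function y ↦ u(x + iy) is nondecreasing on [0, +∞). -/

import Mathlib

open Complex Filter Set

/-- `h` is harmonic on `U`: real-valued, `C²` on `U`, with vanishing Laplacian. -/
def HarmonicOn (h : ℂ → ℝ) (U : Set ℂ) : Prop :=
  ContDiffOn ℝ 2 h U ∧ ∀ z ∈ U,
    iteratedFDerivWithin ℝ 2 h U z ![1, 1] +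
      iteratedFDerivWithin ℝ 2 h U z ![Complex.I, Complex.I] = 0

/-- The subset of `ℂ` corresponding to a subset of `ℝ`. -/
def cplx (E : Set ℝ) : Set ℂ := (fun x : ℝ => (x : ℂ)) '' E


open Topology InnerProductSpace

lemma aux_local_re {u : ℂ → ℝ} {p : ℂ} (h : HarmonicAt u p) :
    ∃ F : ℂ → ℂ, AnalyticAt ℂ F p ∧ ∀ᶠ z in 𝓝 p, (F z).re = u z := by
  obtain ⟨r, hr, hb⟩ := Metric.isOpen_iff.1 (isOpen_setOfPred_harmonicAt (f := u)) p h
  obtain ⟨F, hF, hFe⟩ := InnerProductSpace.HarmonicOnNhd.exists_analyticOnNhd_ball_re_eq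
    (f := u) (z := p) (R := r) (fun _ hy => hb hy)
  refine ⟨F, hF p (Metric.mem_ball_self hr), ?_⟩
  filter_upwards [Metric.ball_mem_nhds p hr] with z hz
  exact hFe hz

lemma aux_comp {u : ℂ → ℝ} {g : ℂ → ℂ} {p : ℂ} (h : HarmonicAt u (g p)) (hg : AnalyticAt ℂ g p) :
    HarmonicAt (fun z => u (g z)) p := by
  obtain ⟨F, hF, hFe⟩ := aux_local_re h
  have h1 : AnalyticAt ℂ (fun z => F (g z)) p := hF.comp hg
  refine (harmonicAt_congr_nhds ?_).1 h1.harmonicAt_re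
  exact hg.continuousAt.eventually hFe

lemma aux_localmax {s : ℂ → ℝ} {p : ℂ} (h : HarmonicAt s p) (hm : IsLocalMax s p) :
    ∀ᶠ z in 𝓝 p, s z = s p := by
  obtain ⟨F, hF, hFe⟩ := aux_local_re h
  have hp : (F p).re = s p := hFe.self_of_nhds
  have h1 : AnalyticAt ℂ (fun z => Complex.exp (F z)) p := hF.cexp
  have h2 : IsLocalMax (norm ∘ fun z => Complex.exp (F z)) p := by
    filter_upwards [hm, hFe] with z hz hz2
    simp only [Function.comp, Complex.norm_exp, hz2, hp]
    exact Real.exp_le_exp.2 hz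
  have h3 := Complex.norm_eventually_eq_of_isLocalMax
    (h1.eventually_analyticAt.mono fun z hz => hz.differentiableAt) h2
  filter_upwards [h3, hFe] with z hz hz2
  simp only [Complex.norm_exp, hz2, hp] at hz
  exact Real.exp_injective hz

lemma aux_mp {D C : Set ℂ} (hD : IsOpen D) (hC : IsClosed C) (hDC : D ⊆ C) {s : ℂ → ℝ}
    (hs : ContinuousOn s C) (hb : ∀ z ∈ C, z ∉ D → s z ≤ 0) (hh : ∀ z ∈ D, HarmonicAt s z)
    {R : ℝ} (hR : ∀ z ∈ C, R ≤ ‖z‖ → s z ≤ 0) : ∀ z ∈ C, s z ≤ 0 := by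
  intro z0 hz0
  by_contra! hpos
  have hK : IsCompact (C ∩ Metric.closedBall 0 R) :=
    (isCompact_closedBall (0:ℂ) R).inter_left hC
  have hz0K : z0 ∈ C ∩ Metric.closedBall 0 R := by
    refine ⟨hz0, ?_⟩
    rw [mem_closedBall_zero_iff]
    by_contra! h
    exact absurd (hR z0 hz0 h.le) (not_le.2 hpos)
  have hsK : ContinuousOn s (C ∩ Metric.closedBall 0 R) := hs.mono inter_subset_left
  obtain ⟨q, hq, hqm⟩ := hK.exists_isMaxOn ⟨z0, hz0K⟩ hsK
  have hqpos : 0 < s q := hpos.trans_le (hqm hz0K)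
  have hall : ∀ z ∈ C, s z ≤ s q := by
    intro z hz
    by_cases h : R ≤ ‖z‖
    · exact (hR z hz h).trans hqpos.le
    · exact hqm ⟨hz, mem_closedBall_zero_iff.2 (not_le.1 h).le⟩
  have hK2 : IsCompact ((C ∩ Metric.closedBall 0 R) ∩ s ⁻¹' {s q}) :=
    hK.of_isClosed_subset (hsK.preimage_isClosed_of_isClosed hK.isClosed isClosed_singleton)
      inter_subset_left
  obtain ⟨p, hp, hpm⟩ := hK2.exists_isMaxOn ⟨q, hq, rfl⟩ Complex.continuous_re.continuousOn
  have hps : s p = s q := hp.2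
  have hpD : p ∈ D := by
    by_contra h
    have := hb p hp.1.1 h
    linarith
  have hlm : IsLocalMax s p := by
    filter_upwards [hD.mem_nhds hpD] with z hz
    rw [hps]; exact hall z (hDC hz)
  have hev := (aux_localmax (hh p hpD) hlm).and (hD.mem_nhds hpD)
  have ht : Tendsto (fun t : ℝ => p + (t : ℂ)) (𝓝[>] 0) (𝓝 p) := by
    have : Continuous (fun t : ℝ => p + (t : ℂ)) := by fun_prop
    have h0 := this.tendsto 0
    simp only [Complex.ofReal_zero, add_zero] at h0
    exact h0.mono_left nhdsWithin_le_nhds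
  obtain ⟨t, ht1, ht2⟩ := ((ht.eventually hev).and self_mem_nhdsWithin).exists
  have ht0 : 0 < t := ht2
  have hmem : p + (t:ℂ) ∈ (C ∩ Metric.closedBall 0 R) ∩ s ⁻¹' {s q} := by
    have hC' := hDC ht1.2
    have hv : s (p + t) = s q := ht1.1.trans hps
    refine ⟨⟨hC', ?_⟩, hv⟩
    rw [mem_closedBall_zero_iff]
    by_contra! h
    have := hR _ hC' h.le
    linarith
  have := hpm hmem
  simp at this
  linarith

lemma aux_eps {s B : ℝ} (hB : 0 ≤ B) (h : ∀ ε > 0, s - ε * B ≤ 0) : s ≤ 0 := by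
  by_contra! hs
  have := h (s / (2 * (B + 1))) (by positivity)
  have h2 : s / (2 * (B + 1)) * B ≤ s / 2 := by
    rw [div_mul_eq_mul_div, div_le_div_iff₀ (by positivity) (by positivity)]
    nlinarith
  linarith

lemma aux_bar {σ : ℝ} (hσ : σ = 1 ∨ σ = -1) {z : ℂ} (hre : 0 ≤ z.re) (him : 0 ≤ σ * z.im) :
    0 ≤ ‖z‖ * (Real.log ‖z + (Real.exp 2 : ℝ)‖ - 2) ∧
    ‖z‖ * (Real.log ‖z + (Real.exp 2 : ℝ)‖ - 2) ≤
      ((1 - σ * I) * z * Complex.log (z + (Real.exp 2 : ℝ))).re := by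
  set w : ℂ := z + (Real.exp 2 : ℝ) with hw
  have he : 0 < Real.exp 2 := Real.exp_pos 2
  have hwre : w.re = z.re + Real.exp 2 := by
    rw [hw, Complex.add_re, Complex.ofReal_re]
  have hwn : Real.exp 2 ≤ ‖w‖ := by
    have := Complex.re_le_norm w
    linarith
  have hlog : 2 ≤ Real.log ‖w‖ := by
    rw [Real.le_log_iff_exp_le (he.trans_le hwn)]; exact hwn
  have harg : |w.arg| ≤ 2 := by
    have h1 : |w.arg| ≤ Real.pi / 2 := Complex.abs_arg_le_pi_div_two_iff.2 (by linarith)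
    have := Real.pi_le_four
    linarith
  refine ⟨mul_nonneg (norm_nonneg _) (by linarith), ?_⟩
  have hm : ‖z‖ ≤ z.re + σ * z.im := by
    have := Complex.norm_le_abs_re_add_abs_im z
    rw [abs_of_nonneg hre] at this
    have h2 : |z.im| = σ * z.im := by
      rcases hσ with rfl | rfl
      · rw [abs_of_nonneg (by linarith)]; ring
      · rw [abs_of_nonpos (by linarith)]; ring
    linarith
  have hexp : ((1 - σ * I) * z * Complex.log w).re =
      (z.re + σ * z.im) * Real.log ‖w‖ - (z.im - σ * z.re) * w.arg := by
    simp only [Complex.mul_re, Complex.mul_im, Complex.sub_re, Complex.sub_im, Complex.one_re,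
      Complex.one_im, Complex.ofReal_re, Complex.ofReal_im, Complex.I_re, Complex.I_im,
      Complex.log_re, Complex.log_im]
    ring
  rw [hexp]
  have h3 : |z.im - σ * z.re| ≤ z.re + σ * z.im := by
    rw [abs_le]
    rcases hσ with rfl | rfl <;> constructor <;> linarith
  have h4 : (z.im - σ * z.re) * w.arg ≤ (z.re + σ * z.im) * 2 := by
    refine (le_abs_self _).trans ?_
    rw [abs_mul]
    exact mul_le_mul h3 harg (abs_nonneg _) (by linarith [norm_nonneg z])
  have h5 : ‖z‖ * (Real.log ‖w‖ - 2) ≤ (z.re + σ * z.im) * (Real.log ‖w‖ - 2) :=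
    mul_le_mul_of_nonneg_right hm (by linarith)
  linarith

lemma aux_quad {D : Set ℂ} (hD : IsOpen D) (hDre : ∀ z ∈ D, 0 < z.re) {s : ℂ → ℝ}
    (hs : Continuous s) (hb : ∀ z : ℂ, 0 ≤ z.re → z ∉ D → s z ≤ 0)
    (hh : ∀ z ∈ D, HarmonicAt s z) {C M : ℝ} (hC : 0 ≤ C) (hM : 0 ≤ M)
    (hgr : ∀ z : ℂ, 0 ≤ z.re → s z ≤ C * (1 + ‖z‖))
    (hray : ∀ t : ℝ, 0 ≤ t → s t ≤ M) {σ : ℝ} (hσ : σ = 1 ∨ σ = -1) :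
    ∀ z : ℂ, 0 ≤ z.re → 0 ≤ σ * z.im → s z ≤ M := by
  intro z hz1 hz2
  have he : 0 < Real.exp 2 := Real.exp_pos 2
  set B : ℂ → ℝ := fun z => ((1 - σ * I) * z * Complex.log (z + (Real.exp 2 : ℝ))).re with hBdef
  have hBbar : ∀ z : ℂ, 0 ≤ z.re → 0 ≤ σ * z.im → 0 ≤ B z :=
    fun z h1 h2 => (aux_bar hσ h1 h2).1.trans (aux_bar hσ h1 h2).2
  have hBan : ∀ z : ℂ, 0 ≤ z.re →
      AnalyticAt ℂ (fun z : ℂ => (1 - σ * I) * z * Complex.log (z + (Real.exp 2 : ℝ))) z := by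
    intro z hz
    have hsl : z + (Real.exp 2 : ℝ) ∈ Complex.slitPlane := by
      left
      rw [Complex.add_re, Complex.ofReal_re]
      linarith
    have h1 : AnalyticAt ℂ (fun z : ℂ => z + (Real.exp 2 : ℝ)) z := by fun_prop
    have h2 : AnalyticAt ℂ (fun z : ℂ => (1 - σ * I) * z) z := by fun_prop
    exact h2.mul (h1.clog hsl)
  have key : ∀ ε > 0, (s z - M) - ε * B z ≤ 0 := by
    intro ε hε
    refine aux_mp (D := D ∩ {z | 0 < σ * z.im}) (C := {z | 0 ≤ z.re ∧ 0 ≤ σ * z.im})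
      (s := fun z => (s z - M) - ε * B z) (R := max 1 (Real.exp (2 + 2 * C / ε)))
      ?_ ?_ ?_ ?_ ?_ ?_ ?_ z ⟨hz1, hz2⟩
    · exact hD.inter (isOpen_lt continuous_const (by fun_prop))
    · have c1 : IsClosed {z : ℂ | 0 ≤ z.re} := isClosed_le continuous_const (by fun_prop)
      have c2 : IsClosed {z : ℂ | 0 ≤ σ * z.im} := isClosed_le continuous_const (by fun_prop)
      exact c1.inter c2
    · rintro w ⟨h1, h2⟩
      exact ⟨(hDre w h1).le, le_of_lt h2⟩
    · refine (hs.continuousOn.sub continuousOn_const).sub (continuousOn_const.mul ?_)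
      intro w hw
      exact (Complex.continuous_re.continuousAt.comp (hBan w hw.1).continuousAt).continuousWithinAt
    · rintro w ⟨h1, h2⟩ h3
      have hB := mul_nonneg hε.le (hBbar w h1 h2)
      have : s w ≤ M := by
        by_cases hwD : w ∈ D
        · have h4 : ¬ (0 < σ * w.im) := fun h => h3 ⟨hwD, h⟩
          have h5 : w.im = 0 := by
            rcases hσ with rfl | rfl <;> linarith
          have h6 : w = (w.re : ℂ) := Complex.ext (by simp) (by simp [h5])
          rw [h6]; exact hray _ h1
        · exact (hb w h1 hwD).trans hM
      show (s w - M) - ε * B w ≤ 0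
      linarith
    · rintro w ⟨h1, -⟩
      have h2 : HarmonicAt B w := (hBan w (hDre w h1).le).harmonicAt_re
      have h3 : HarmonicAt (fun _ : ℂ => M) w := (harmonicOnNhd_const M) w (mem_univ w)
      exact ((hh w h1).sub h3).sub (h2.const_smul (c := ε))
    · rintro w ⟨h1, h2⟩ hw
      show (s w - M) - ε * B w ≤ 0
      have hw1 : 1 ≤ ‖w‖ := (le_max_left _ _).trans hw
      have hw2 : Real.exp (2 + 2 * C / ε) ≤ ‖w‖ := (le_max_right _ _).trans hw
      have hB := (aux_bar hσ h1 h2).2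
      have hnle : ‖w‖ ≤ ‖w + (Real.exp 2 : ℝ)‖ := by
        rw [Complex.norm_def, Complex.norm_def]
        apply Real.sqrt_le_sqrt
        simp only [Complex.normSq_apply, Complex.add_re, Complex.add_im, Complex.ofReal_re,
          Complex.ofReal_im]
        nlinarith
      have hl : 2 + 2 * C / ε ≤ Real.log ‖w + (Real.exp 2 : ℝ)‖ := by
        rw [Real.le_log_iff_exp_le (by linarith)]
        exact hw2.trans hnle
      have h5 : ‖w‖ * (2 * C / ε) ≤ B w :=
        (mul_le_mul_of_nonneg_left (by linarith) (norm_nonneg w)).trans hB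
      have h6 : ε * (‖w‖ * (2 * C / ε)) ≤ ε * B w := mul_le_mul_of_nonneg_left h5 hε.le
      have h7 : ε * (‖w‖ * (2 * C / ε)) = 2 * C * ‖w‖ := by field_simp
      have h8 := hgr w h1
      nlinarith
  have := aux_eps (hBbar z hz1 hz2) key
  linarith

lemma aux_PL {D : Set ℂ} (hD : IsOpen D) (hDre : ∀ z ∈ D, 0 < z.re) {s : ℂ → ℝ}
    (hs : Continuous s) (hb : ∀ z : ℂ, 0 ≤ z.re → z ∉ D → s z ≤ 0)
    (hh : ∀ z ∈ D, HarmonicAt s z) {C M : ℝ} (hC : 0 ≤ C) (hM : 0 ≤ M)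
    (hgr : ∀ z : ℂ, 0 ≤ z.re → s z ≤ C * (1 + ‖z‖))
    (hray : ∀ t : ℝ, 0 ≤ t → s t ≤ M) :
    ∀ z : ℂ, 0 ≤ z.re → s z ≤ 0 := by
  have hbd : ∀ z : ℂ, 0 ≤ z.re → s z ≤ M := by
    intro z hz
    rcases le_total 0 z.im with h | h
    · exact aux_quad hD hDre hs hb hh hC hM hgr hray (σ := 1) (Or.inl rfl) z hz (by linarith)
    · exact aux_quad hD hDre hs hb hh hC hM hgr hray (σ := -1) (Or.inr rfl) z hz (by linarith)
  intro z hz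
  set B : ℂ → ℝ := fun z => Real.log ‖z + 1‖ with hB
  have hre : ∀ z : ℂ, 0 ≤ z.re → 1 ≤ ‖z + 1‖ := by
    intro z hz
    have := Complex.re_le_norm (z + 1)
    simp at this
    linarith
  have hB0 : ∀ z : ℂ, 0 ≤ z.re → 0 ≤ B z := fun z hz => Real.log_nonneg (hre z hz)
  have hne : ∀ z : ℂ, 0 ≤ z.re → z + 1 ≠ 0 := by
    intro z hz h
    have := hre z hz
    rw [h, norm_zero] at this
    linarith
  refine aux_eps (hB0 z hz) ?_
  intro ε hε
  refine aux_mp (D := D) (C := {z | 0 ≤ z.re}) (s := fun z => s z - ε * B z)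
      (R := Real.exp (M / ε)) hD ?_ ?_ ?_ ?_ ?_ ?_ z hz
  · exact isClosed_le continuous_const (by fun_prop)
  · exact fun w hw => (hDre w hw).le
  · refine hs.continuousOn.sub (continuousOn_const.mul ?_)
    refine ContinuousOn.log (by fun_prop) ?_
    intro w hw
    exact norm_ne_zero_iff.2 (hne w hw)
  · intro w hw hwD
    have := mul_nonneg hε.le (hB0 w hw)
    have := hb w hw hwD
    show s w - ε * B w ≤ 0
    linarith
  · intro w hw
    have h1 : AnalyticAt ℂ (fun z : ℂ => z + 1) w := by fun_prop
    have h2 : HarmonicAt B w := h1.harmonicAt_log_norm (hne w (hDre w hw).le)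
    exact (hh w hw).sub (h2.const_smul (c := ε))
  · intro w hw hwR
    show s w - ε * B w ≤ 0
    have h0 : 0 ≤ w.re := hw
    have hnle : ‖w‖ ≤ ‖w + 1‖ := by
      rw [Complex.norm_def, Complex.norm_def]
      apply Real.sqrt_le_sqrt
      simp only [Complex.normSq_apply, Complex.add_re, Complex.add_im, Complex.one_re,
        Complex.one_im]
      nlinarith
    have hl : M / ε ≤ B w := by
      rw [hB]
      show M / ε ≤ Real.log ‖w + 1‖
      rw [Real.le_log_iff_exp_le (by linarith [hre w hw])]
      exact hwR.trans hnle
    rw [div_le_iff₀ hε] at hl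
    have := hbd w hw
    linarith

lemma aux_harnack {u : ℂ → ℝ} (hu : ∀ z, 0 ≤ u z) (hc : Continuous u) {c w : ℂ} {R : ℝ}
    (hh : HarmonicOnNhd u (Metric.closedBall c R)) (hw : w ∈ Metric.ball c R) :
    u w ≤ (R + ‖w - c‖) / (R - ‖w - c‖) * u c := by
  have hR : 0 < R := Metric.pos_of_mem_ball hw
  have h1 := hh.circleAverage_re_herglotzRieszKernel_smul hw
  have h2 : Real.circleAverage u c R = u c :=
    InnerProductSpace.HarmonicOnNhd.circleAverage_eq (by rwa [abs_of_pos hR])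
  have h3 : Real.circleAverage (((R + ‖w - c‖) / (R - ‖w - c‖)) • u) c R =
      ((R + ‖w - c‖) / (R - ‖w - c‖)) • u c := by
    rw [Real.circleAverage_smul, h2]
  rw [smul_eq_mul] at h3
  rw [← h1, ← h3]
  apply Real.circleAverage_mono
  · apply ContinuousOn.circleIntegrable'
    exact (Complex.continuous_re.comp_continuousOn
      (continuousOn_herglotzRieszKernel_sphere hw)).smul hc.continuousOn
  · exact (hc.const_smul _).continuousOn.circleIntegrable'
  · intro z hz
    rw [abs_of_pos hR] at hz
    exact mul_le_mul_of_nonneg_right (re_herglotzRieszKernel_le hz hw) (hu z)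

theorem stmt11 (E : Set ℝ) (hEne : E.Nonempty) (hEcl : IsClosed E)
    (u : ℂ → ℝ) (hu_cont : Continuous u)
    (hu_zero : ∀ x ∈ E, u (x : ℂ) = 0)
    (hu_pos : ∀ z ∈ (cplx E)ᶜ, 0 < u z)
    (hu_harm : HarmonicOn u (cplx E)ᶜ)
    (hu_symm : ∀ z : ℂ, u (starRingEnd ℂ z) = u z)
    (hu_growth : ∃ A : ℝ, ∀ z : ℂ, u z ≤ A * (1 + ‖z‖)) :
    ∀ x : ℝ, MonotoneOn (fun y : ℝ => u ((x : ℂ) + (y : ℂ) * Complex.I)) (Ici 0) := by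
  obtain ⟨A, hA⟩ := hu_growth
  have hcl : IsClosed (cplx E) :=
    Complex.isometry_ofReal.isClosedEmbedding.isClosedMap E hEcl
  have hop : IsOpen (cplx E)ᶜ := hcl.isOpen_compl
  have hharm : ∀ z ∈ (cplx E)ᶜ, HarmonicAt u z := by
    intro z hz
    refine ⟨hu_harm.1.contDiffAt (hop.mem_nhds hz), ?_⟩
    filter_upwards [hop.mem_nhds hz] with w hw
    rw [laplacian_eq_iteratedFDeriv_complexPlane]
    have := hu_harm.2 w hw
    rw [iteratedFDerivWithin_of_isOpen 2 hop hw] at this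
    exact this
  have hz0 : ∀ z ∈ cplx E, u z = 0 := by
    rintro _ ⟨x, hx, rfl⟩; exact hu_zero x hx
  have hnn : ∀ z, 0 ≤ u z := by
    intro z
    by_cases h : z ∈ cplx E
    · rw [hz0 z h]
    · exact (hu_pos z h).le
  have him : ∀ z : ℂ, z.im ≠ 0 → z ∈ (cplx E)ᶜ := by
    rintro z hz ⟨x, -, rfl⟩; simp at hz
  have hA0 : 0 ≤ A := by
    have h1 := hA 0
    have h2 := hnn 0
    simp at h1
    linarith
  intro x y hy y' hy' hyy'
  rcases hyy'.eq_or_lt with rfl | hlt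
  · exact le_rfl
  have hy0 : 0 ≤ y := hy
  obtain ⟨a, ha⟩ : ∃ a : ℝ, a = (y + y') / 2 := ⟨_, rfl⟩
  have ha0 : 0 < a := by rw [ha]; linarith
  set g1 : ℂ → ℂ := fun ζ => I * (a - ζ) with hg1
  set g2 : ℂ → ℂ := fun ζ => -I * (a + ζ) with hg2
  have hg1im : ∀ ζ, (g1 ζ).im = a - ζ.re := by intro ζ; simp [hg1]
  have hg2im : ∀ ζ, (g2 ζ).im = -(a + ζ.re) := by intro ζ; simp [hg2]
  have hn1 : ∀ ζ, ‖g1 ζ‖ ≤ a + ‖ζ‖ := by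
    intro ζ
    have := norm_sub_le (a : ℂ) ζ
    simpa [hg1, abs_of_pos ha0] using this
  have hn2 : ∀ ζ, ‖g2 ζ‖ ≤ a + ‖ζ‖ := by
    intro ζ
    have := norm_add_le (a : ℂ) ζ
    simpa [hg2, abs_of_pos ha0] using this
  have main := aux_PL (D := {ζ | 0 < ζ.re} ∩ g1 ⁻¹' (cplx E)ᶜ)
    (s := fun ζ => u (g1 ζ) - u (g2 ζ)) (C := A * (1 + a)) (M := A * (3 + 15 * a))
    ((isOpen_lt continuous_const Complex.continuous_re).inter (hop.preimage (by fun_prop)))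
    (fun z hz => hz.1) (by fun_prop) ?_ ?_ (by positivity) (by positivity) ?_ ?_
    (((a - y : ℝ) : ℂ) + x * I) (by simp; linarith)
  · have e1 : g1 (((a - y : ℝ) : ℂ) + x * I) = (x : ℂ) + y * I := by
      apply Complex.ext <;> simp [hg1]
    have e2 : g2 (((a - y : ℝ) : ℂ) + x * I) = starRingEnd ℂ ((x : ℂ) + y' * I) := by
      apply Complex.ext
      · simp [hg2]
      · simp [hg2]; rw [ha]; ring
    simp only [e1, e2, hu_symm] at main
    show u (x + y * I) ≤ u (x + y' * I)
    linarith
  · intro z hz hzD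
    rcases hz.eq_or_lt with h0 | h0
    · have : g2 z = starRingEnd ℂ (g1 z) := by
        apply Complex.ext
        · simp [hg1, hg2]
        · simp [hg1, hg2, ← h0]
      simp [this, hu_symm]
    · have : g1 z ∈ cplx E := by
        by_contra h
        exact hzD ⟨h0, h⟩
      have h2 := hnn (g2 z)
      show u (g1 z) - u (g2 z) ≤ 0
      rw [hz0 _ this]; linarith
  · rintro z ⟨hz1, hz2⟩
    have hz1' : 0 < z.re := hz1
    refine HarmonicAt.sub (f₁ := fun ζ => u (g1 ζ)) (f₂ := fun ζ => u (g2 ζ)) ?_ ?_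
    · exact aux_comp (hharm _ hz2) (by fun_prop)
    · refine aux_comp (hharm _ (him _ ?_)) (by fun_prop)
      rw [hg2im]; intro h; linarith
  · intro z hz
    have h1 := hA (g1 z)
    have h2 := hnn (g2 z)
    have h3 := mul_le_mul_of_nonneg_left (hn1 z) hA0
    show u (g1 z) - u (g2 z) ≤ _
    have h4 : 0 ≤ A * a * ‖z‖ := by positivity
    nlinarith
  · intro t ht
    show u (g1 t) - u (g2 t) ≤ _
    have hnt : ‖(t : ℂ)‖ = t := by simp [abs_of_nonneg ht]
    by_cases h4 : t ≤ 4 * a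
    · have h1 := hA (g1 t)
      have h2 := hnn (g2 t)
      have h3 := hn1 t
      rw [hnt] at h3
      have h5 := mul_le_mul_of_nonneg_left (h3.trans (add_le_add_right h4 a)) hA0
      have h6 : 0 ≤ A * a := by positivity
      nlinarith
    · push Not at h4
      have ht0 : 0 < t := by linarith
      have hd : ‖g1 t - g2 t‖ = 2 * a := by
        have : g1 t - g2 t = I * ((2 * a : ℝ) : ℂ) := by simp [hg1, hg2]; ring
        rw [this, norm_mul, Complex.norm_I, one_mul, Complex.norm_real, Real.norm_of_nonneg]
        positivity
      have hH := aux_harnack hnn hu_cont (c := g2 t) (w := g1 t) (R := t) ?_ ?_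
      · rw [hd] at hH
        have h1 : u (g1 t) - u (g2 t) ≤ 4 * a / (t - 2 * a) * u (g2 t) := by
          have : (t + 2 * a) / (t - 2 * a) = 1 + 4 * a / (t - 2 * a) := by
            have : t - 2 * a ≠ 0 := by linarith
            field_simp; ring
          rw [this] at hH
          linarith
        refine h1.trans ?_
        have h2 := hA (g2 t)
        have h3 := hn2 t
        rw [hnt] at h3
        have h5 : u (g2 t) ≤ A * (1 + a + t) :=
          h2.trans (mul_le_mul_of_nonneg_left (by linarith) hA0)
        rw [div_mul_eq_mul_div, div_le_iff₀ (by linarith)]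
        have h6 : 4 * a * u (g2 t) ≤ 4 * a * (A * (1 + a + t)) :=
          mul_le_mul_of_nonneg_left h5 (by positivity)
        refine h6.trans ?_
        have h7 : 4 * a * (1 + a + t) ≤ (3 + 15 * a) * (t - 2 * a) := by nlinarith
        nlinarith [mul_le_mul_of_nonneg_left h7 hA0]
      · intro z hz
        apply hharm z (him z _)
        rw [mem_closedBall_iff_norm] at hz
        have h1 := (Complex.abs_im_le_norm (z - g2 t)).trans hz
        rw [Complex.sub_im, hg2im, Complex.ofReal_re, abs_le] at h1
        intro h
        linarith [h1.2]
      · rw [mem_ball_iff_norm, hd]; linarith
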